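/- arXiv:1808.08363 — 4 statements merged into one kernel-verified Lean document; each statement's English description precedes it below -/
import Mathlib

section
/- Let r ≥ 1, m, a, s be natural numbers and let S₁, …, Sₘ be subsets of a finite set of size a (e.g. S : Fin m → Finset (Fin a)). Suppose that for every r-element subset T of the index set {1,…,m}, the intersection ⋂_{j ∈ T} S_j has at most s elements. Then Σ_{j=1}^m |S_j| ≤ r · (m · a^{(r-1)/r} · s^{1/r} + a), where the powers a^{(r-1)/r} and s^{1/r} are real powers (Real.rpow) of the casts of a and s. -/
/-- Double counting of the pairs `(T, q)` with `T` an `r`-set of indices and `q` in the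
intersection indexed by `T`. -/
theorem sum_choose_card_filter_mem_le {ι α : Type*} [Fintype ι] [DecidableEq ι] [Fintype α]
    [DecidableEq α] (r s : ℕ) (S : ι → Finset α)
    (hs : ∀ T : Finset ι, T.card = r →
      (Finset.univ.filter (fun q : α => ∀ j ∈ T, q ∈ S j)).card ≤ s) :
    ∑ q : α, (Finset.univ.filter (fun j => q ∈ S j)).card.choose r ≤
      (Fintype.card ι).choose r * s := by
  have key : ∀ q : α, (Finset.univ.filter (fun j => q ∈ S j)).card.choose r =
      (((Finset.univ : Finset ι).powersetCard r).filter (fun T => ∀ j ∈ T, q ∈ S j)).card := by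
    intro q
    rw [← Finset.card_powersetCard]
    congr 1
    ext T
    simp only [Finset.mem_powersetCard, Finset.mem_filter, Finset.subset_iff, Finset.mem_univ,
      true_and]
    tauto
  have count := Finset.sum_card_bipartiteAbove_eq_sum_card_bipartiteBelow
    (s := (Finset.univ : Finset α)) (t := (Finset.univ : Finset ι).powersetCard r)
    (fun q T => ∀ j ∈ T, q ∈ S j)
  simp only [Finset.bipartiteAbove, Finset.bipartiteBelow] at count
  rw [Finset.sum_congr rfl fun q _ => key q, count]
  refine (Finset.sum_le_card_nsmul _ _ s fun T hT => hs T (Finset.mem_powersetCard.1 hT).2).trans ?_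
  simp [Finset.card_powersetCard]

theorem sum_card_eq_sum_card_filter_mem {ι α : Type*} [Fintype ι] [Fintype α] [DecidableEq α]
    (S : ι → Finset α) :
    ∑ j, (S j).card = ∑ q : α, (Finset.univ.filter (fun j => q ∈ S j)).card := by
  have count := Finset.sum_card_bipartiteAbove_eq_sum_card_bipartiteBelow
    (s := (Finset.univ : Finset ι)) (t := (Finset.univ : Finset α)) (fun j q => q ∈ S j)
  simpa [Finset.bipartiteAbove, Finset.bipartiteBelow] using count

theorem sum_pow_succ_sub_le {α : Type*} [Fintype α] (d : α → ℕ) (r m s : ℕ)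
    (h : ∑ q, (d q).choose r ≤ m.choose r * s) :
    ∑ q, (d q + 1 - r) ^ r ≤ m ^ r * s :=
  calc ∑ q, (d q + 1 - r) ^ r ≤ ∑ q, (d q).descFactorial r :=
        Finset.sum_le_sum fun q _ => Nat.pow_sub_le_descFactorial _ _
    _ = r.factorial * ∑ q, (d q).choose r := by
        simp only [Nat.descFactorial_eq_factorial_mul_choose, Finset.mul_sum]
    _ ≤ r.factorial * (m.choose r * s) := Nat.mul_le_mul_left _ h
    _ = m.descFactorial r * s := by rw [Nat.descFactorial_eq_factorial_mul_choose, mul_assoc]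
    _ ≤ m ^ r * s := Nat.mul_le_mul_right _ (Nat.descFactorial_le_pow _ _)

theorem sum_le_of_sum_pow_le {α : Type*} [Fintype α] (x : α → ℝ) (hx : ∀ q, 0 ≤ x q)
    {r : ℕ} (hr : 1 ≤ r) {m s : ℝ} (hm : 0 ≤ m) (hs : 0 ≤ s)
    (h : ∑ q, x q ^ r ≤ m ^ r * s) :
    ∑ q, x q ≤ m * (Fintype.card α : ℝ) ^ (((r : ℝ) - 1) / r) * s ^ (1 / (r : ℝ)) := by
  obtain ⟨n, rfl⟩ : ∃ n, r = n + 1 := ⟨r - 1, by omega⟩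
  have hr0 : ((n + 1 : ℕ) : ℝ) ≠ 0 := by positivity
  have ha : (0 : ℝ) ≤ Fintype.card α := Nat.cast_nonneg _
  refine le_of_pow_le_pow_left₀ n.succ_ne_zero (by positivity) ?_
  rw [mul_pow, mul_pow, ← Real.rpow_natCast (_ ^ _), ← Real.rpow_mul ha,
    ← Real.rpow_natCast (s ^ _), ← Real.rpow_mul hs, div_mul_cancel₀ _ hr0,
    div_mul_cancel₀ _ hr0, Real.rpow_one, Nat.cast_succ, add_sub_cancel_right, Real.rpow_natCast]
  calc (∑ q, x q) ^ (n + 1) ≤ (Fintype.card α : ℝ) ^ n * ∑ q, x q ^ (n + 1) :=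
        pow_sum_le_card_mul_sum_pow (fun q _ => hx q) n
    _ ≤ (Fintype.card α : ℝ) ^ n * (m ^ (n + 1) * s) := by gcongr
    _ = _ := by rw [Nat.succ_eq_add_one]; ring

theorem kovari_sos_turan_type_intersection_bound
    (r m a s : ℕ) (hr : 1 ≤ r) (S : Fin m → Finset (Fin a))
    (hs : ∀ T : Finset (Fin m), T.card = r →
      (Finset.univ.filter (fun q : Fin a => ∀ j ∈ T, q ∈ S j)).card ≤ s) :
    ((∑ j, (S j).card : ℕ) : ℝ) ≤
      (r : ℝ) * ((m : ℝ) * (a : ℝ) ^ (((r : ℝ) - 1) / (r : ℝ)) * (s : ℝ) ^ (1 / (r : ℝ)) + (a : ℝ)) := by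
  set d : Fin a → ℕ := fun q => (Finset.univ.filter (fun j => q ∈ S j)).card with hd
  have hpow : ∑ q, (d q + 1 - r) ^ r ≤ m ^ r * s :=
    sum_pow_succ_sub_le d r m s (by simpa using sum_choose_card_filter_mem_le r s S fun T hT => by convert hs T hT)
  have hsum := sum_le_of_sum_pow_le (fun q => ((d q + 1 - r : ℕ) : ℝ)) (fun _ => Nat.cast_nonneg _)
    hr (Nat.cast_nonneg m) (Nat.cast_nonneg s) (by exact_mod_cast hpow)
  rw [Fintype.card_fin] at hsum
  have hsplit : ∑ j, (S j).card ≤ ∑ q, (d q + 1 - r) + r * a := by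
    rw [sum_card_eq_sum_card_filter_mem S]
    calc ∑ q, d q ≤ ∑ q, ((d q + 1 - r) + r) := Finset.sum_le_sum fun q _ => by omega
      _ = _ := by simp [Finset.sum_add_distrib, mul_comm]
  have hr1 : (1 : ℝ) ≤ r := by exact_mod_cast hr
  calc ((∑ j, (S j).card : ℕ) : ℝ) ≤ ∑ q, ((d q + 1 - r : ℕ) : ℝ) + r * a := by
        exact_mod_cast hsplit
    _ ≤ r * (m * (a : ℝ) ^ (((r : ℝ) - 1) / r) * (s : ℝ) ^ (1 / (r : ℝ))) + r * a := by
        gcongr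
        exact hsum.trans (le_mul_of_one_le_left (by positivity) hr1)
    _ = _ := by ring
end

section
/- Let r ≥ 1, m, a be natural numbers and let S₁, …, Sₘ be subsets of a finite set of size a (e.g. S : Fin m → Finset (Fin a)). Then a^{r-1} · Σ_{(j₁,…,j_r) ∈ {1,…,m}^r} |S_{j₁} ∩ … ∩ S_{j_r}| ≥ (Σ_{j=1}^m |S_j|)^r, where the outer sum ranges over all r-tuples of indices (repetitions allowed) and all quantities are natural numbers. -/
/-- Double counting: the sizes of the `r`-fold intersections add up to the sum of the `r`-th powers
of the multiplicities of the points. -/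
lemma sum_card_filter_forall_mem {ι α : Type*} [Fintype ι] [Fintype α] [DecidableEq α]
    (r : ℕ) (S : ι → Finset α) :
    ∑ f : Fin r → ι, (Finset.univ.filter (fun q : α => ∀ i : Fin r, q ∈ S (f i))).card =
      ∑ q : α, (∑ j, if q ∈ S j then 1 else 0) ^ r := by
  simp_rw [Finset.card_filter]
  rw [Finset.sum_comm]
  refine Finset.sum_congr rfl fun q _ => ?_
  rw [Finset.sum_pow', Fintype.piFinset_univ]
  simp [Finset.prod_ite_zero]

theorem power_sum_intersection_inequality
    (r m a : ℕ) (hr : 1 ≤ r) (S : Fin m → Finset (Fin a)) :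
    (∑ j, (S j).card) ^ r ≤
      a ^ (r - 1) *
        ∑ f : Fin r → Fin m,
          (Finset.univ.filter (fun q : Fin a => ∀ i : Fin r, q ∈ S (f i))).card := by
  obtain ⟨n, rfl⟩ := Nat.exists_eq_add_of_le' hr
  have hsum : ∑ j, (S j).card = ∑ q : Fin a, ∑ j, if q ∈ S j then 1 else 0 := by
    rw [Finset.sum_comm]
    simp
  rw [sum_card_filter_forall_mem, hsum]
  simpa using pow_sum_le_card_mul_sum_pow (s := (Finset.univ : Finset (Fin a)))
    (f := fun q => ∑ j, if q ∈ S j then 1 else 0) (fun _ _ => Nat.zero_le _) n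
end

section
/- Let r ≥ 1, m, a, s be natural numbers and let S₁, …, Sₘ be subsets of a finite set of size a. Suppose that for every r-element subset T of the index set {1,…,m}, the intersection ⋂_{j ∈ T} S_j has at most s elements. For each point q of the ground set let d_q be the number of indices j with q ∈ S_j. Then (Σ_{q : d_q ≥ r} d_q)^r ≤ r^r · a^{r-1} · s · (m choose r), where the sum on the left ranges over the points q of the ground set with d_q ≥ r, and all quantities are natural numbers. -/
theorem Nat.pow_le_pow_self_mul_choose {r d : ℕ} (h : r ≤ d) :
    d ^ r ≤ r ^ r * d.choose r := by
  induction r generalizing d with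
  | zero => simp
  | succ k ih =>
    obtain ⟨e, rfl⟩ : ∃ e, d = e + 1 := ⟨d - 1, by omega⟩
    have hke : k ≤ e := by omega
    have key : (e + 1) ^ k ≤ (k + 1) ^ k * e.choose k := by
      obtain rfl | hk := Nat.eq_zero_or_pos k
      · simp
      refine Nat.le_of_mul_le_mul_left ?_ (pow_pos hk k)
      calc k ^ k * (e + 1) ^ k = (k * (e + 1)) ^ k := (mul_pow ..).symm
        _ ≤ ((k + 1) * e) ^ k := Nat.pow_le_pow_left (by nlinarith) k
        _ = (k + 1) ^ k * e ^ k := mul_pow ..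
        _ ≤ (k + 1) ^ k * (k ^ k * e.choose k) := Nat.mul_le_mul_left _ (ih hke)
        _ = k ^ k * ((k + 1) ^ k * e.choose k) := by ring
    calc (e + 1) ^ (k + 1) = (e + 1) ^ k * (e + 1) := pow_succ ..
      _ ≤ (k + 1) ^ k * e.choose k * (e + 1) := Nat.mul_le_mul_right _ key
      _ = (k + 1) ^ k * ((e + 1) * e.choose k) := by ring
      _ = (k + 1) ^ (k + 1) * (e + 1).choose (k + 1) := by
        rw [Nat.add_one_mul_choose_eq]; ring

/-- Double counting of pairs of a point and an `r`-set of indices whose sets all contain it. -/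
theorem Finset.sum_choose_card_filter_mem {ι α : Type*} [Fintype ι] [Fintype α]
    [DecidableEq α] (S : ι → Finset α) [∀ q (T : Finset ι), Decidable (∀ j ∈ T, q ∈ S j)]
    (r : ℕ) :
    ∑ q, (univ.filter fun j => q ∈ S j).card.choose r =
      ∑ T ∈ powersetCard r univ, (univ.filter fun q => ∀ j ∈ T, q ∈ S j).card := by
  refine Eq.trans (sum_congr rfl fun q _ => ?_)
    (sum_card_bipartiteAbove_eq_sum_card_bipartiteBelow
      fun (q : α) (T : Finset ι) => ∀ j ∈ T, q ∈ S j)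
  rw [← card_powersetCard]
  congr 1
  ext T
  simp [bipartiteAbove, mem_powersetCard, subset_iff, and_comm]

theorem high_degree_sum_pow_le
    (r m a s : ℕ) (hr : 1 ≤ r) (S : Fin m → Finset (Fin a))
    (hs : ∀ T : Finset (Fin m), T.card = r →
      (Finset.univ.filter (fun q : Fin a => ∀ j ∈ T, q ∈ S j)).card ≤ s) :
    (∑ q ∈ Finset.univ.filter
        (fun q : Fin a => r ≤ (Finset.univ.filter (fun j : Fin m => q ∈ S j)).card),
        (Finset.univ.filter (fun j : Fin m => q ∈ S j)).card) ^ r ≤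
      r ^ r * a ^ (r - 1) * s * Nat.choose m r := by
  set d : Fin a → ℕ := fun q => (Finset.univ.filter fun j : Fin m => q ∈ S j).card with hd
  set Q : Finset (Fin a) := Finset.univ.filter fun q => r ≤ d q
  have hQ : Q.card ≤ a := by simpa using Q.card_le_univ
  have power_mean : (∑ q ∈ Q, d q) ^ r ≤ Q.card ^ (r - 1) * ∑ q ∈ Q, d q ^ r := by
    have h := pow_sum_le_card_mul_sum_pow (s := Q) (f := d) (fun _ _ => Nat.zero_le _) (r - 1)
    rwa [Nat.sub_add_cancel hr] at h
  have count : ∑ q, (d q).choose r ≤ m.choose r * s := by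
    rw [hd, Finset.sum_choose_card_filter_mem]
    calc _ ≤ ∑ T ∈ Finset.powersetCard r (Finset.univ : Finset (Fin m)), s :=
          Finset.sum_le_sum fun T hT => hs T (Finset.mem_powersetCard.mp hT).2
      _ = m.choose r * s := by simp
  calc (∑ q ∈ Q, d q) ^ r ≤ Q.card ^ (r - 1) * ∑ q ∈ Q, d q ^ r := power_mean
    _ ≤ a ^ (r - 1) * ∑ q ∈ Q, r ^ r * (d q).choose r :=
      Nat.mul_le_mul (Nat.pow_le_pow_left hQ _) <| Finset.sum_le_sum fun q hq =>
        Nat.pow_le_pow_self_mul_choose (Finset.mem_filter.mp hq).2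
    _ ≤ a ^ (r - 1) * (r ^ r * ∑ q, (d q).choose r) := by
      rw [← Finset.mul_sum]
      gcongr
      exact Finset.subset_univ Q
    _ ≤ a ^ (r - 1) * (r ^ r * (m.choose r * s)) := by gcongr
    _ = r ^ r * a ^ (r - 1) * s * m.choose r := by ring
end

section
/- Let d ≥ 1, r ≥ 1, n, s be natural numbers. Let F be a finite family of (d+1)-element subsets of an n-element vertex set V (the d-dimensional simplices of a complex), and let A be the family of all d-element subsets τ of V that are contained in some member of F; set a = |A|. For a vertex v ∈ V, let lk(v) = { τ ∈ A : v ∉ τ and τ ∪ {v} ∈ F }. Suppose that for every r-element set W of vertices, |⋂_{v ∈ W} lk(v)| ≤ s. Then (d+1) · |F| ≤ r · (n · a^{(r-1)/r} · s^{1/r} + a), where the powers a^{(r-1)/r} and s^{1/r} are real powers (Real.rpow) of the casts of a and s. -/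
/-- Double counting the pairs consisting of a `d`-set `τ ∈ A` and a member of `F` containing it. -/
theorem mul_card_le_sum_card_extensions {α : Type*} [Fintype α] [DecidableEq α] {d : ℕ}
    {F A : Finset (Finset α)} (hF : ∀ σ ∈ F, σ.card = d + 1)
    (hA : ∀ τ, τ ∈ A ↔ τ.card = d ∧ ∃ σ ∈ F, τ ⊆ σ) :
    (d + 1) * F.card ≤
      ∑ τ ∈ A, (Finset.univ.filter (fun v => v ∉ τ ∧ insert v τ ∈ F)).card := by
  have hfaces : ∀ σ ∈ F, (A.filter (fun τ => τ ⊆ σ)).card = d + 1 := by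
    intro σ hσ
    have heq : A.filter (fun τ => τ ⊆ σ) = Finset.powersetCard d σ := by
      ext τ
      simp only [Finset.mem_filter, hA, Finset.mem_powersetCard]
      exact ⟨fun h => ⟨h.2, h.1.1⟩, fun h => ⟨⟨h.2, σ, hσ, h.1⟩, h.1⟩⟩
    rw [heq, Finset.card_powersetCard, hF σ hσ, Nat.choose_succ_self_right]
  calc (d + 1) * F.card
      = ∑ σ ∈ F, (A.filter (fun τ => τ ⊆ σ)).card := by
        rw [Finset.sum_congr rfl hfaces, Finset.sum_const, smul_eq_mul, mul_comm]
    _ = ∑ τ ∈ A, (F.filter (fun σ => τ ⊆ σ)).card :=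
        (Finset.sum_card_bipartiteAbove_eq_sum_card_bipartiteBelow _).symm
    _ ≤ _ := by
        refine Finset.sum_le_sum fun τ hτ => ?_
        refine (Finset.card_le_card fun σ hσ => ?_).trans
          (Finset.card_image_le (f := fun v => insert v τ))
        obtain ⟨hσF, hτσ⟩ := Finset.mem_filter.mp hσ
        obtain ⟨v, hv, rfl⟩ := Finset.exists_eq_insert_iff.mpr
          ⟨hτσ, by rw [((hA τ).mp hτ).1, hF σ hσF]⟩
        exact Finset.mem_image_of_mem _ (by simp [hv, hσF])

/-- The counting step of the Kővári–Sós–Turán argument. -/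
theorem sum_choose_card_le {α β : Type*} [Fintype α] (A : Finset β)
    (R : α → β → Prop) [∀ v b, Decidable (R v b)] {r s : ℕ}
    (hs : ∀ W : Finset α, W.card = r → (A.filter (fun b => ∀ v ∈ W, R v b)).card ≤ s) :
    ∑ b ∈ A, (Finset.univ.filter (fun v => R v b)).card.choose r ≤
      (Fintype.card α).choose r * s := by
  classical
  calc ∑ b ∈ A, (Finset.univ.filter (fun v => R v b)).card.choose r
      = ∑ b ∈ A, ((Finset.powersetCard r Finset.univ).filter
          (fun W : Finset α => ∀ v ∈ W, R v b)).card := by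
        refine Finset.sum_congr rfl fun b _ => ?_
        rw [← Finset.card_powersetCard]
        congr 1
        ext W
        simp [Finset.mem_powersetCard, Finset.subset_iff, and_comm]
    _ = ∑ W ∈ Finset.powersetCard r (Finset.univ : Finset α),
          (A.filter (fun b => ∀ v ∈ W, R v b)).card :=
        Finset.sum_card_bipartiteAbove_eq_sum_card_bipartiteBelow
          (fun (b : β) (W : Finset α) => ∀ v ∈ W, R v b)
    _ ≤ (Finset.powersetCard r (Finset.univ : Finset α)).card • s :=
        Finset.sum_le_card_nsmul _ _ _ fun W hW => by
          convert! hs W (Finset.mem_powersetCard.mp hW).2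
    _ = _ := by rw [Finset.card_powersetCard, Finset.card_univ, smul_eq_mul]

/-- A bound on binomial moments bounds the sum, by the power mean inequality. -/
theorem sum_le_of_sum_choose_le {β : Type*} (A : Finset β) (f : β → ℕ) {n r s : ℕ} (hr : 1 ≤ r)
    (h : ∑ b ∈ A, (f b).choose r ≤ n.choose r * s) :
    ((∑ b ∈ A, f b : ℕ) : ℝ) ≤
      n * (A.card : ℝ) ^ (((r : ℝ) - 1) / r) * (s : ℝ) ^ (1 / (r : ℝ)) + (r - 1) * A.card := by
  obtain ⟨k, rfl⟩ : ∃ k, r = k + 1 := ⟨r - 1, by omega⟩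
  have hmom : ∑ b ∈ A, (f b - k) ^ (k + 1) ≤ n ^ (k + 1) * s :=
    calc ∑ b ∈ A, (f b - k) ^ (k + 1)
        ≤ ∑ b ∈ A, (k + 1).factorial * (f b).choose (k + 1) := by
          refine Finset.sum_le_sum fun b _ => ?_
          rw [← Nat.descFactorial_eq_factorial_mul_choose]
          simpa using Nat.pow_sub_le_descFactorial (f b) (k + 1)
      _ ≤ (k + 1).factorial * (n.choose (k + 1) * s) := by
          rw [← Finset.mul_sum]
          exact Nat.mul_le_mul_left _ h
      _ ≤ n ^ (k + 1) * s := by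
          rw [← mul_assoc, ← Nat.descFactorial_eq_factorial_mul_choose]
          exact Nat.mul_le_mul_right _ (Nat.descFactorial_le_pow n (k + 1))
  have hmean : (∑ b ∈ A, ((f b - k : ℕ) : ℝ)) ≤
      n * (A.card : ℝ) ^ ((((k + 1 : ℕ) : ℝ) - 1) / (k + 1 : ℕ)) *
        (s : ℝ) ^ (1 / ((k + 1 : ℕ) : ℝ)) := by
    refine le_of_pow_le_pow_left₀ (Nat.succ_ne_zero k) (by positivity) ?_
    have hk : ((k : ℝ) + 1) ≠ 0 := by positivity
    have ha : ((A.card : ℝ) ^ ((((k + 1 : ℕ) : ℝ) - 1) / (k + 1 : ℕ))) ^ (k + 1) =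
        (A.card : ℝ) ^ k := by
      rw [← Real.rpow_mul_natCast (by positivity), ← Real.rpow_natCast]
      congr 1
      push_cast
      field_simp
      ring
    have hs' : ((s : ℝ) ^ (1 / ((k + 1 : ℕ) : ℝ))) ^ (k + 1) = s := by
      rw [one_div]
      exact Real.rpow_inv_natCast_pow (by positivity) (Nat.succ_ne_zero k)
    rw [mul_pow, mul_pow, ha, hs']
    have hmom' : (∑ b ∈ A, ((f b - k : ℕ) : ℝ) ^ (k + 1)) ≤ (n : ℝ) ^ (k + 1) * s := by
      exact_mod_cast hmom
    calc (∑ b ∈ A, ((f b - k : ℕ) : ℝ)) ^ (k + 1)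
        ≤ (A.card : ℝ) ^ k * ∑ b ∈ A, ((f b - k : ℕ) : ℝ) ^ (k + 1) :=
          pow_sum_le_card_mul_sum_pow (fun _ _ => by positivity) k
      _ ≤ (A.card : ℝ) ^ k * ((n : ℝ) ^ (k + 1) * s) := by gcongr
      _ = _ := by rw [Nat.succ_eq_add_one]; ring
  have hsplit : ((∑ b ∈ A, f b : ℕ) : ℝ) ≤ (∑ b ∈ A, ((f b - k : ℕ) : ℝ)) + k * A.card := by
    have : ∑ b ∈ A, f b ≤ ∑ b ∈ A, (f b - k) + k * A.card := by
      rw [mul_comm, ← smul_eq_mul, ← Finset.sum_const, ← Finset.sum_add_distrib]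
      exact Finset.sum_le_sum fun b _ => by omega
    exact_mod_cast this
  have hcast : (((k + 1 : ℕ) : ℝ) - 1) * A.card = k * A.card := by push_cast; ring
  linarith

theorem simplicial_inductive_step_bound
    (d r n s : ℕ) (hd : 1 ≤ d) (hr : 1 ≤ r)
    (F : Finset (Finset (Fin n)))
    (hF : ∀ σ ∈ F, σ.card = d + 1)
    (A : Finset (Finset (Fin n)))
    (hA : A = Finset.univ.filter (fun τ : Finset (Fin n) => τ.card = d ∧ ∃ σ ∈ F, τ ⊆ σ))
    (a : ℕ) (ha : a = A.card)
    (hs : ∀ W : Finset (Fin n), W.card = r →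
      (A.filter (fun τ => ∀ v ∈ W, v ∉ τ ∧ insert v τ ∈ F)).card ≤ s) :
    (((d + 1) * F.card : ℕ) : ℝ) ≤
      (r : ℝ) * ((n : ℝ) * (a : ℝ) ^ (((r : ℝ) - 1) / (r : ℝ)) * (s : ℝ) ^ (1 / (r : ℝ)) + (a : ℝ)) := by
  subst ha
  have hcount := mul_card_le_sum_card_extensions hF (A := A) (by simp [hA])
  have hchoose := sum_choose_card_le A (fun v τ => v ∉ τ ∧ insert v τ ∈ F) (r := r) (s := s)
    (fun W hW => by convert! hs W hW)
  rw [Fintype.card_fin] at hchoose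
  have hsum := sum_le_of_sum_choose_le A _ hr hchoose
  have hr' : (1 : ℝ) ≤ r := by exact_mod_cast hr
  have hM : 0 ≤ (n : ℝ) * (A.card : ℝ) ^ (((r : ℝ) - 1) / (r : ℝ)) * (s : ℝ) ^ (1 / (r : ℝ)) := by
    positivity
  have hcard : (0 : ℝ) ≤ A.card := by positivity
  refine (Nat.cast_le.mpr hcount).trans (hsum.trans ?_)
  nlinarith [mul_nonneg (sub_nonneg.mpr hr') hM]
end
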